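/- Let Γ be a finite connected non-complete graph of prime valency p that is 2-geodesic transitive but not 2-arc transitive. Then Γ is geodesic transitive: for every i with 1 ≤ i ≤ 3 (the diameter of Γ), Aut Γ acts transitively on the set of i-geodesics of Γ. -/

import Mathlib

open SimpleGraph

/-- `Γ` is arc transitive: its automorphism group is transitive on ordered pairs
of adjacent vertices. -/
def ArcTransitive {V : Type*} (Γ : SimpleGraph V) : Prop :=
  ∀ ⦃v u v' u' : V⦄, Γ.Adj v u → Γ.Adj v' u' →
    ∃ φ : Γ ≃g Γ, φ v = v' ∧ φ u = u'

/-- `(v,u,w)` is a 2-arc of `Γ`. -/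
def Is2Arc {V : Type*} (Γ : SimpleGraph V) (v u w : V) : Prop :=
  Γ.Adj v u ∧ Γ.Adj u w ∧ v ≠ w

/-- `(v,u,w)` is a 2-geodesic of `Γ`: a 2-arc with `v`, `w` non-adjacent. -/
def Is2Geodesic {V : Type*} (Γ : SimpleGraph V) (v u w : V) : Prop :=
  Γ.Adj v u ∧ Γ.Adj u w ∧ v ≠ w ∧ ¬ Γ.Adj v w

/-- `Γ` is 2-arc transitive: arc transitive and transitive on 2-arcs. -/
def TwoArcTransitive {V : Type*} (Γ : SimpleGraph V) : Prop :=
  ArcTransitive Γ ∧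
  ∀ ⦃v u w v' u' w' : V⦄, Is2Arc Γ v u w → Is2Arc Γ v' u' w' →
    ∃ φ : Γ ≃g Γ, φ v = v' ∧ φ u = u' ∧ φ w = w'

/-- `Γ` is 2-geodesic transitive: arc transitive and transitive on 2-geodesics. -/
def TwoGeodesicTransitive {V : Type*} (Γ : SimpleGraph V) : Prop :=
  ArcTransitive Γ ∧
  ∀ ⦃v u w v' u' w' : V⦄, Is2Geodesic Γ v u w → Is2Geodesic Γ v' u' w' →
    ∃ φ : Γ ≃g Γ, φ v = v' ∧ φ u = u' ∧ φ w = w'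

/-- `f 0, f 1, …, f i` is an `i`-geodesic of `Γ`: a path whose endpoints are at
graph distance `i`. -/
def IsIGeodesic {V : Type*} (Γ : SimpleGraph V) (i : ℕ) (f : ℕ → V) : Prop :=
  (∀ j < i, Γ.Adj (f j) (f (j + 1))) ∧ Γ.dist (f 0) (f i) = i

theorem exists_powerSum_ne_zero {F : Type*} [Field F] (S : Finset F) (h0 : (0 : F) ∉ S)
    (hS : S.Nonempty) : ∃ j, 1 ≤ j ∧ j ≤ S.card ∧ ∑ t ∈ S, t ^ j ≠ 0 := by
  classical
  obtain ⟨t₀, ht₀⟩ := hS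
  by_contra! hcon
  set Q : Polynomial F := Polynomial.X * ∏ t ∈ S.erase t₀, (Polynomial.X - Polynomial.C t) with hQ
  have hdeg : Q.natDegree < S.card + 1 := by
    have h1 : (∏ t ∈ S.erase t₀, (Polynomial.X - Polynomial.C t)).natDegree = (S.erase t₀).card := by
      rw [Polynomial.natDegree_prod_of_monic _ _ fun t _ => Polynomial.monic_X_sub_C t]
      simp
    have h2 := Polynomial.natDegree_mul_le (p := (Polynomial.X : Polynomial F))
      (q := ∏ t ∈ S.erase t₀, (Polynomial.X - Polynomial.C t))
    rw [h1, Polynomial.natDegree_X, Finset.card_erase_of_mem ht₀, ← hQ] at h2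
    have := Finset.card_pos.2 ⟨t₀, ht₀⟩
    omega
  have hzero : ∑ t ∈ S, Q.eval t = 0 := by
    simp_rw [Polynomial.eval_eq_sum_range' hdeg]
    rw [Finset.sum_comm]
    refine Finset.sum_eq_zero fun j hj => ?_
    rw [← Finset.mul_sum]
    rcases Nat.eq_zero_or_pos j with rfl | hpos
    · simp [hQ]
    · rw [hcon j hpos (by simpa [Nat.lt_succ_iff] using hj), mul_zero]
  rw [Finset.sum_eq_single_of_mem t₀ ht₀] at hzero
  · simp only [hQ, Polynomial.eval_mul, Polynomial.eval_X, Polynomial.eval_prod,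
      Polynomial.eval_sub, Polynomial.eval_C, mul_eq_zero, Finset.prod_eq_zero_iff] at hzero
    rcases hzero with h | ⟨t, ht, h⟩
    · exact h0 (h ▸ ht₀)
    · exact (Finset.mem_erase.1 ht).1 (sub_eq_zero.1 h).symm
  · intro t ht hne
    rw [hQ, Polynomial.eval_mul, Polynomial.eval_prod,
      Finset.prod_eq_zero (Finset.mem_erase.2 ⟨hne, ht⟩) (by simp), mul_zero]

theorem not_forall_sum_eval_add {p : ℕ} [Fact p.Prime] {S : Finset (ZMod p)} {k : ℕ}
    (hk : 1 ≤ k) (hlow : ∀ j, 1 ≤ j → j < k → ∑ t ∈ S, t ^ j = 0) (hne : ∑ t ∈ S, t ^ k ≠ 0)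
    (f : Polynomial (ZMod p)) (hkf : k ≤ f.natDegree) (hfp : f.natDegree < p)
    (hsum : ∀ x, ∑ t ∈ S, f.eval (x + t) = S.card * f.eval x) : False := by
  set n := f.natDegree with hn
  set R : Polynomial (ZMod p) := ∑ j ∈ Finset.Ico 1 (n + 1),
    Polynomial.C (∑ t ∈ S, t ^ j) * Polynomial.hasseDeriv j f with hR
  have hRdeg : R.degree < p := by
    refine lt_of_le_of_lt ?_ (Nat.cast_lt.2 hfp)
    rw [← Polynomial.natDegree_le_iff_degree_le]
    refine Polynomial.natDegree_sum_le_of_forall_le _ _ fun j _ => ?_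
    refine (Polynomial.natDegree_C_mul_le _ _).trans ?_
    exact (Polynomial.natDegree_hasseDeriv_le f j).trans (Nat.sub_le _ _)
  have hReval : ∀ x, R.eval x = 0 := by
    intro x
    have h1 : ∀ t, f.eval (x + t) =
        ∑ j ∈ Finset.range (n + 1), (Polynomial.hasseDeriv j f).eval x * t ^ j := by
      intro t
      rw [add_comm x t, ← Polynomial.taylor_eval, Polynomial.eval_eq_sum_range'
        (n := n + 1) (by rw [Polynomial.natDegree_taylor]; omega)]
      simp [Polynomial.taylor_coeff]
    have h2 := hsum x
    simp_rw [h1] at h2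
    rw [Finset.sum_comm, Finset.range_eq_Ico, Finset.sum_eq_sum_Ico_succ_bot (by omega)] at h2
    simp only [Polynomial.hasseDeriv_zero', pow_zero, mul_one, Finset.sum_const, nsmul_eq_mul,
      zero_add, add_eq_left] at h2
    rw [hR, Polynomial.eval_finsetSum, ← h2]
    refine Finset.sum_congr rfl fun j _ => ?_
    rw [Polynomial.eval_C_mul, mul_comm, Finset.mul_sum]
  have hR0 : R = 0 := by
    refine Polynomial.eq_zero_of_degree_lt_of_eval_finset_eq_zero Finset.univ ?_
      fun x _ => hReval x
    simpa [ZMod.card] using hRdeg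
  have hcoeff : R.coeff (n - k) = (∑ t ∈ S, t ^ k) * ((n.choose k : ℕ) * f.leadingCoeff) := by
    rw [hR, Polynomial.finsetSum_coeff, Finset.sum_eq_single k]
    · rw [Polynomial.coeff_C_mul, Polynomial.hasseDeriv_coeff, Nat.sub_add_cancel hkf,
        Polynomial.leadingCoeff]
    · intro j hj hjk
      rw [Polynomial.coeff_C_mul]
      rcases lt_or_gt_of_ne hjk with h | h
      · rw [hlow j (Finset.mem_Ico.1 hj).1 h, zero_mul]
      · rw [Polynomial.hasseDeriv_coeff, Polynomial.coeff_eq_zero_of_natDegree_lt (n := n - k + j)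
          (by omega), mul_zero, mul_zero]
    · intro h
      exact absurd (Finset.mem_Ico.2 ⟨hk, by omega⟩) h
  rw [hR0, Polynomial.coeff_zero] at hcoeff
  have hchoose : ((n.choose k : ℕ) : ZMod p) ≠ 0 := by
    rw [Ne, ZMod.natCast_eq_zero_iff]
    intro h
    have h1 : p ∣ n.factorial := by
      rw [← Nat.choose_mul_factorial_mul_factorial hkf, mul_assoc]
      exact h.mul_right _
    exact absurd (((Fact.out : p.Prime).dvd_factorial).1 h1) (by omega)
  have hlead : f.leadingCoeff ≠ 0 := by
    rw [Ne, Polynomial.leadingCoeff_eq_zero]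
    rintro rfl
    simp at hn
    omega
  exact mul_ne_zero hne (mul_ne_zero hchoose hlead) hcoeff.symm

theorem exists_affine_of_card_lt {p : ℕ} [Fact p.Prime] {S : Finset (ZMod p)}
    (h0 : 0 ∉ S) (hneg : ∀ t ∈ S, -t ∈ S) (hS : S.Nonempty) (hcard : 2 * S.card < p)
    (g : ZMod p → ZMod p) (hg : Function.Injective g)
    (hgS : ∀ x, ∀ t ∈ S, g (x + t) - g x ∈ S) :
    ∃ a b, ∀ x, g x = a * x + b := by
  classical
  have hp : p.Prime := Fact.out
  have hex := exists_powerSum_ne_zero S h0 hS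
  have hex' : ∃ j, 1 ≤ j ∧ ∑ t ∈ S, t ^ j ≠ 0 := by
    obtain ⟨j, h1, -, h2⟩ := hex
    exact ⟨j, h1, h2⟩
  set k := Nat.find hex' with hkdef
  obtain ⟨hk1, hkne⟩ := Nat.find_spec hex'
  have hlow : ∀ j, 1 ≤ j → j < k → ∑ t ∈ S, t ^ j = 0 := by
    intro j hj hjk
    by_contra h
    exact Nat.find_min hex' hjk ⟨hj, h⟩
  have hkp : 2 * k < p := by
    obtain ⟨j, h1, h3, h2⟩ := hex
    have : k ≤ j := Nat.find_min' hex' ⟨h1, h2⟩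
    omega
  have hk2 : 2 ≤ k := by
    rcases hk1.lt_or_eq with h | h
    · exact h
    · exfalso
      rw [← h] at hkne
      simp only [pow_one] at hkne
      have hs : ∑ t ∈ S, t = -∑ t ∈ S, t := by
        rw [← Finset.sum_neg_distrib]
        exact Finset.sum_nbij' (fun t => -t) (fun t => -t) hneg hneg (by simp) (by simp) (by simp)
      have h2 : (2 : ZMod p) * ∑ t ∈ S, t = 0 := by linear_combination hs
      rcases mul_eq_zero.1 h2 with h2 | h2
      · have h3 : ((2 : ℕ) : ZMod p) = 0 := by exact_mod_cast h2
        rw [ZMod.natCast_eq_zero_iff] at h3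
        have := Nat.le_of_dvd (by norm_num) h3
        omega
      · exact hkne h2
  set P := Lagrange.interpolate (Finset.univ : Finset (ZMod p)) id g with hP
  have hPeval : ∀ x, P.eval x = g x := fun x =>
    Lagrange.eval_interpolate_at_node (v := id) g (Function.injective_id.injOn) (Finset.mem_univ x)
  have hPdeg : P.natDegree < p := by
    have h1 := Lagrange.degree_interpolate_lt (s := (Finset.univ : Finset (ZMod p))) (v := id) g
      (Function.injective_id.injOn)
    rw [Finset.card_univ, ZMod.card] at h1
    by_cases hP0 : P = 0
    · simpa [hP0] using hp.pos
    · exact (Polynomial.natDegree_lt_iff_degree_lt hP0).2 h1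
  have himage : ∀ x, S.image (fun t => g (x + t) - g x) = S := by
    intro x
    refine Finset.eq_of_subset_of_card_le ?_ ?_
    · intro y hy
      obtain ⟨t, ht, rfl⟩ := Finset.mem_image.1 hy
      exact hgS x t ht
    · rw [Finset.card_image_of_injective]
      intro s t hst
      exact add_left_cancel (hg (sub_left_injective hst))
  have hpow : ∀ m, 1 ≤ m → m < k → ¬ (k ≤ m * P.natDegree ∧ m * P.natDegree < p) := by
    rintro m hm1 hmk ⟨h1, h2⟩
    rw [← Polynomial.natDegree_pow] at h1 h2
    refine not_forall_sum_eval_add hk1 hlow hkne (P ^ m) h1 h2 fun x => ?_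
    simp only [Polynomial.eval_pow, hPeval]
    have h3 : ∑ t ∈ S, g (x + t) ^ m = ∑ s ∈ S, (s + g x) ^ m := by
      conv_rhs => rw [← himage x]
      rw [Finset.sum_image]
      · simp
      · intro s _ t _ hst
        exact add_left_cancel (hg (sub_left_injective hst))
    rw [h3]
    simp_rw [add_pow]
    rw [Finset.sum_comm, Finset.sum_eq_single 0]
    · simp
    · intro j hj hj0
      simp_rw [mul_assoc]
      rw [← Finset.sum_mul, hlow j (by omega) (by simp at hj; omega), zero_mul]
    · simp
  have hd : P.natDegree < k := by
    by_contra! h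
    exact hpow 1 le_rfl (by omega) (by omega)
  have hd1 : P.natDegree ≤ 1 := by
    by_contra! h
    set d := P.natDegree
    have e1 := Nat.div_add_mod (k + d - 1) d
    have e2 := Nat.mod_lt (k + d - 1) (by omega : d > 0)
    set m := (k + d - 1) / d
    have e3 : 2 * m ≤ d * m := Nat.mul_le_mul_right _ h
    have hm0 : m ≠ 0 := by
      intro hm
      rw [hm] at e1
      omega
    exact hpow m (by omega) (by omega) (by rw [mul_comm m d]; omega)
  refine ⟨P.coeff 1, P.coeff 0, fun x => ?_⟩
  rw [← hPeval x]
  conv_lhs => rw [Polynomial.eq_X_add_C_of_natDegree_le_one hd1]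
  simp

theorem exists_cycle_coordinates {X : Type*} [Fintype X] {p : ℕ} [Fact p.Prime]
    (hX : Fintype.card X = p) (M : Subgroup (Equiv.Perm X))
    (htr : ∀ x y, ∃ g ∈ M, g x = y) :
    ∃ σ ∈ M, ∃ e : ZMod p ≃ X, ∀ i, σ (e i) = e (i + 1) := by
  classical
  have hp : p.Prime := Fact.out
  obtain ⟨x₀⟩ : Nonempty X := Fintype.card_pos_iff.1 (hX ▸ hp.pos)
  have : MulAction.IsPretransitive M X := ⟨fun x y => by
    obtain ⟨g, hg, h⟩ := htr x y
    exact ⟨⟨g, hg⟩, h⟩⟩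
  have hdvd : p ∣ Nat.card M := by
    rw [← hX, ← Nat.card_eq_fintype_card, ← MulAction.index_stabilizer_of_transitive M x₀]
    exact Subgroup.index_dvd_card _
  obtain ⟨⟨σ, hσM⟩, hσ⟩ := exists_prime_orderOf_dvd_card' p hdvd
  have hσ' : orderOf σ = p := by
    rw [← hσ, Subgroup.orderOf_mk]
  have hcyc : σ.IsCycle :=
    Equiv.Perm.isCycle_of_prime_order'' (hX.symm ▸ hp) (hσ'.trans hX.symm)
  have hsupp : ∀ x, σ x ≠ x := by
    intro x
    have h1 := hcyc.orderOf
    rw [hσ', ← hX] at h1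
    have h2 := (Finset.card_eq_iff_eq_univ _).1 h1.symm
    exact Equiv.Perm.mem_support.1 (h2 ▸ Finset.mem_univ x)
  have hval : ∀ n : ℕ, σ ^ ((n : ZMod p).val) = σ ^ n := by
    intro n
    rw [ZMod.val_natCast, ← hσ', pow_mod_orderOf]
  have hsurj : Function.Surjective fun i : ZMod p => (σ ^ i.val) x₀ := by
    intro y
    obtain ⟨n, hn⟩ := hcyc.exists_pow_eq (hsupp x₀) (hsupp y)
    exact ⟨n, by simp only [hval, hn]⟩
  refine ⟨σ, hσM, Equiv.ofBijective _ ((Fintype.bijective_iff_surjective_and_card _).2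
    ⟨hsurj, by rw [ZMod.card, hX]⟩), fun i => ?_⟩
  have h := hval (i.val + 1)
  rw [Nat.cast_add, ZMod.natCast_zmod_val, Nat.cast_one] at h
  simp only [Equiv.ofBijective_apply]
  rw [h, pow_succ', Equiv.Perm.mul_apply]

theorem translation_subset_eq_zero {p : ℕ} [Fact p.Prime] {C : Finset (ZMod p)} {b : ZMod p}
    (hC : C.Nonempty) (hcard : C.card < p) (h : ∀ x ∈ C, x + b ∈ C) : b = 0 := by
  classical
  have himage : C.image (fun x => x + b) = C := by
    refine Finset.eq_of_subset_of_card_le ?_ ?_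
    · intro y hy
      obtain ⟨t, ht, rfl⟩ := Finset.mem_image.1 hy
      exact h t ht
    · rw [Finset.card_image_of_injective _ (add_left_injective b)]
  have hsum : ∑ x ∈ C, x = ∑ x ∈ C, (x + b) := by
    conv_lhs => rw [← himage]
    exact Finset.sum_image fun _ _ _ _ h => add_left_injective b h
  rw [Finset.sum_add_distrib, Finset.sum_const, nsmul_eq_mul, left_eq_add, mul_eq_zero] at hsum
  rcases hsum with h | h
  · rw [ZMod.natCast_eq_zero_iff] at h
    exact absurd (Nat.le_of_dvd (Finset.card_pos.2 hC) h) (by omega)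
  · exact h

theorem card_dvd_of_multipliers {p : ℕ} [Fact p.Prime] {T : Finset (ZMod p)} (h0 : 0 ∉ T)
    (hT : T.Nonempty)
    (hmul : ∀ t ∈ T, ∀ t' ∈ T, ∃ a, a * t = t' ∧ ∀ s, s ∈ T ↔ a * s ∈ T) :
    T.card ∣ p - 1 := by
  classical
  obtain ⟨t₀, ht₀⟩ := hT
  have ht₀0 : t₀ ≠ 0 := fun h => h0 (h ▸ ht₀)
  let K : Subgroup (ZMod p)ˣ :=
    { carrier := {a | ∀ s, s ∈ T ↔ a * s ∈ T}
      mul_mem' := fun {a b} ha hb s => by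
        rw [hb s, ha, Units.val_mul, mul_assoc]
      one_mem' := fun s => by simp
      inv_mem' := fun {a} ha s => by
        rw [ha (↑a⁻¹ * s), Units.mul_inv_cancel_left] }
  have hcard : Nat.card K = T.card := by
    rw [← Nat.card_eq_finsetCard]
    refine Nat.card_congr (Equiv.ofBijective
      (fun a : K => (⟨a.1 * t₀, (a.2 t₀).1 ht₀⟩ : T)) ⟨?_, ?_⟩)
    · intro a b hab
      exact Subtype.ext (Units.ext (mul_right_cancel₀ ht₀0 (Subtype.ext_iff.1 hab)))
    · rintro ⟨t, ht⟩
      obtain ⟨a, ha, haT⟩ := hmul t₀ ht₀ t ht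
      have ha0 : a ≠ 0 := by
        rintro rfl
        exact h0 (by rwa [← ha, zero_mul] at ht)
      exact ⟨⟨Units.mk0 a ha0, haT⟩, Subtype.ext ha⟩
  rw [← hcard, ← ZMod.card_units p, ← Nat.card_eq_fintype_card]
  exact Subgroup.card_subgroup_dvd_card K

/-- If `T` is a coset of the index two subgroup of `(ZMod p)ˣ`, then the complement of the Cayley
graph of `T` has the parameters of a Paley graph. -/
theorem two_mul_card_compl_eq {p : ℕ} [Fact p.Prime] {T : Finset (ZMod p)} (h0 : 0 ∉ T)
    (hneg : ∀ t ∈ T, -t ∈ T) (hcard : 2 * T.card + 1 = p)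
    (hmul : ∀ t ∈ T, ∀ t' ∈ T, ∃ a, a * t = t' ∧ ∀ s, s ∈ T ↔ a * s ∈ T) {w : ZMod p}
    (hw : w ∈ T) :
    2 * (Finset.univ.filter fun s => s ∉ T ∧ s - w ∉ T).card = T.card := by
  classical
  set S := Finset.univ.filter fun s : ZMod p => s ≠ 0 ∧ s ∉ T with hS
  have hSmem : ∀ s, s ∈ S ↔ s ≠ 0 ∧ s ∉ T := by simp [hS]
  have hScard : S.card = T.card := by
    have h1 : (Finset.univ : Finset (ZMod p)) = insert 0 (T ∪ S) := by
      ext s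
      simp only [Finset.mem_univ, Finset.mem_insert, Finset.mem_union, hSmem, true_iff]
      tauto
    have h2 := congrArg Finset.card h1
    rw [Finset.card_univ, ZMod.card, Finset.card_insert_of_notMem (by simp [h0, hSmem]),
      Finset.card_union_of_disjoint] at h2
    · omega
    · rw [Finset.disjoint_left]
      intro s hs hs'
      exact ((hSmem s).1 hs').2 hs
  have hTS : ∀ k t, k ≠ 0 → t ∈ T → k * t ∉ T → ∀ t ∈ T, k * t ∈ S := by
    intro k t hk ht hkt t' ht'
    rw [hSmem]
    refine ⟨mul_ne_zero hk fun h => h0 (h ▸ ht'), fun h => hkt ?_⟩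
    obtain ⟨a, ha, haT⟩ := hmul t' ht' (k * t') h
    rw [← mul_right_cancel₀ (fun h => h0 (h ▸ ht')) ha]
    exact (haT t).1 ht
  have hST : ∀ k t, k ≠ 0 → t ∈ T → k * t ∉ T → ∀ s, k * s ∈ T ↔ s ∈ S := by
    intro k t hk ht hkt s
    have himage : T.image (fun x => k * x) = S := by
      refine Finset.eq_of_subset_of_card_le ?_ ?_
      · intro y hy
        obtain ⟨t', ht', rfl⟩ := Finset.mem_image.1 hy
        exact hTS k t hk ht hkt t' ht'
      · rw [Finset.card_image_of_injective _ (mul_right_injective₀ hk), hScard]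
    constructor
    · intro h
      rw [hSmem]
      refine ⟨fun hs => h0 (by rwa [hs, mul_zero] at h), fun hs => ?_⟩
      exact ((hSmem _).1 (hTS k t hk ht hkt s hs)).2 h
    · intro hs
      by_contra h
      have h1 : k * s ∈ S := (hSmem _).2 ⟨mul_ne_zero hk ((hSmem s).1 hs).1, h⟩
      rw [← himage] at h1
      obtain ⟨t', ht', h2⟩ := Finset.mem_image.1 h1
      exact ((hSmem s).1 hs).2 (mul_left_cancel₀ hk h2 ▸ ht')
  set r : ZMod p → ℕ := fun w => (T.filter fun s => s - w ∈ T).card with hr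
  set μ : ZMod p → ℕ := fun w => (Finset.univ.filter fun s => s ∉ T ∧ s - w ∉ T).card with hμ
  have hμr : ∀ w ∈ T, μ w = r w + 1 := by
    intro w hw
    have hT' : (Finset.univ.filter fun s => s - w ∈ T).card = T.card :=
      Finset.card_nbij' (fun s => s - w) (fun s => s + w) (by simp [Set.MapsTo])
        (by simp [Set.MapsTo]) (by simp [Set.LeftInvOn]) (by simp [Set.LeftInvOn])
    have h1 : μ w = (T ∪ Finset.univ.filter fun s => s - w ∈ T)ᶜ.card := by
      refine congrArg Finset.card (Finset.ext fun s => ?_)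
      simp
    have h2 : r w = (T ∩ Finset.univ.filter fun s => s - w ∈ T).card := by
      refine congrArg Finset.card (Finset.ext fun s => ?_)
      simp
    have h3 := Finset.card_union_add_card_inter T (Finset.univ.filter fun s => s - w ∈ T)
    have h4 := Finset.card_add_card_compl (T ∪ Finset.univ.filter fun s => s - w ∈ T)
    rw [ZMod.card] at h4
    omega
  have hrμ : ∀ w ∈ T, ∀ s ∈ S, r s = μ w := by
    intro w hw s hs
    have hw0 : w ≠ 0 := fun h => h0 (h ▸ hw)
    have hk : s / w ≠ 0 := div_ne_zero ((hSmem s).1 hs).1 hw0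
    have hkw : s / w * w = s := div_mul_cancel₀ s hw0
    have hkey := hST (s / w) w hk hw (hkw.symm ▸ ((hSmem s).1 hs).2)
    refine (Finset.card_nbij (fun x => s / w * x) ?_ (mul_right_injective₀ hk).injOn ?_).symm
    · intro x hx
      simp only [Finset.coe_filter, Finset.mem_univ, true_and, Set.mem_ofPred_eq] at hx ⊢
      have hx0 : x ≠ 0 := by
        rintro rfl
        exact hx.2 (by simpa using hneg w hw)
      have hxw : x - w ≠ 0 := by
        rw [sub_ne_zero]
        rintro rfl
        exact hx.1 hw
      refine ⟨(hkey x).2 ((hSmem x).2 ⟨hx0, hx.1⟩), ?_⟩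
      rw [← hkw, mul_div_assoc, div_self hw0, mul_one, ← mul_sub]
      exact (hkey _).2 ((hSmem _).2 ⟨hxw, hx.2⟩)
    · intro y hy
      simp only [Finset.coe_filter, Set.mem_ofPred_eq] at hy
      have hyx : s / w * (y / (s / w)) = y := mul_div_cancel₀ y hk
      refine ⟨y / (s / w), ?_, hyx⟩
      simp only [Finset.coe_filter, Finset.mem_univ, true_and, Set.mem_ofPred_eq]
      refine ⟨((hSmem _).1 ((hkey _).1 (hyx.symm ▸ hy.1))).2,
        ((hSmem _).1 ((hkey _).1 ?_)).2⟩
      rw [mul_sub, hyx, hkw]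
      exact hy.2
  have hsum : ∑ w, r w = T.card * T.card := by
    simp only [hr, Finset.card_filter]
    rw [Finset.sum_comm]
    simp only [← Finset.card_filter]
    rw [← smul_eq_mul, ← Finset.sum_const]
    refine Finset.sum_congr rfl fun s _ => ?_
    exact Finset.card_nbij' (fun w => s - w) (fun w => s - w) (by simp [Set.MapsTo])
        (by simp [Set.MapsTo]) (by simp [Set.LeftInvOn]) (by simp [Set.LeftInvOn])
  have hsplit : ∑ w, r w = r 0 + (∑ w ∈ T, r w + ∑ w ∈ S, r w) := by
    have h1 : (Finset.univ : Finset (ZMod p)) = insert 0 (T ∪ S) := by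
      ext s
      simp only [Finset.mem_univ, Finset.mem_insert, Finset.mem_union, hSmem, true_iff]
      tauto
    rw [h1, Finset.sum_insert (by simp [h0, hSmem]), Finset.sum_union]
    rw [Finset.disjoint_left]
    intro s hs hs'
    exact ((hSmem s).1 hs').2 hs
  have hr0 : r 0 = T.card := by simp [hr]
  have hTpos := Finset.card_pos.2 ⟨w, hw⟩
  obtain ⟨s₀, hs₀⟩ := Finset.card_pos.1 (hScard ▸ hTpos)
  have hrT : ∀ t ∈ T, r t = r w := by
    intro t ht
    have h1 := hrμ t ht s₀ hs₀
    have h2 := hrμ w hw s₀ hs₀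
    rw [hμr t ht] at h1
    rw [hμr w hw] at h2
    omega
  rw [Finset.sum_congr rfl hrT, Finset.sum_congr rfl (hrμ w hw), Finset.sum_const,
    Finset.sum_const, hScard, hr0, hsum, smul_eq_mul, smul_eq_mul, hμr w hw] at hsplit
  have h5 : T.card = 1 + (r w + (r w + 1)) := by
    apply Nat.eq_of_mul_eq_mul_left hTpos
    rw [hsplit]
    ring
  change 2 * μ w = T.card
  rw [hμr w hw]
  omega

theorem affine_orbits {p : ℕ} [Fact p.Prime] (M : Subgroup (Equiv.Perm (ZMod p)))
    (haff : ∀ g ∈ M, ∃ a b : ZMod p, ∀ x, g x = a * x + b) {C : Finset (ZMod p)}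
    (htr : ∀ x ∈ C, ∀ y ∈ C, ∃ g ∈ M, g x = y) (hinv : ∀ g ∈ M, ∀ x ∈ C, g x ∈ C)
    (hC : 2 ≤ C.card) (hcard : 2 * C.card + 1 = p) :
    ∃ x₀ ∉ C, (∀ g ∈ M, g x₀ = x₀) ∧
      ∀ x ∉ C, ∀ y ∉ C, x ≠ x₀ → y ≠ x₀ → ∃ g ∈ M, g x = y := by
  classical
  have htrans : ∀ g ∈ M, ∀ b, (∀ x, g x = x + b) → b = 0 := by
    intro g hg b h
    refine translation_subset_eq_zero (C := C) (Finset.card_pos.1 (by omega)) (by omega) ?_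
    intro x hx
    rw [← h]
    exact hinv g hg x hx
  have hslope : ∀ g ∈ M, ∀ g' ∈ M, ∀ a b b' : ZMod p, (∀ x, g x = a * x + b) →
      (∀ x, g' x = a * x + b') → g = g' := by
    intro g hg g' hg' a b b' h h'
    have ha : a ≠ 0 := by
      rintro rfl
      exact zero_ne_one (g.injective ((h 0).trans (by rw [h 1, zero_mul, zero_mul])))
    have h1 : ∀ x, (g⁻¹ * g') x = x + (b' - b) / a := by
      intro x
      rw [Equiv.Perm.mul_apply, Equiv.Perm.inv_eq_iff_eq, h, h']
      field_simp
      ring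
    have h2 := htrans _ (M.mul_mem (M.inv_mem hg) hg') _ h1
    rw [h2] at h1
    ext1 x
    have h3 := h1 x
    rw [add_zero, Equiv.Perm.mul_apply, Equiv.Perm.inv_eq_iff_eq] at h3
    exact h3.symm
  obtain ⟨c, hc, c', hc', hcc⟩ := Finset.one_lt_card.1 (by omega : 1 < C.card)
  obtain ⟨g, hg, hgc⟩ := htr c hc c' hc'
  obtain ⟨a, b, hab⟩ := haff g hg
  have ha1 : a ≠ 1 := by
    rintro rfl
    have h1 := htrans g hg b fun x => by rw [hab, one_mul]
    rw [hab, h1, one_mul, add_zero] at hgc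
    exact hcc hgc
  have ha1' : 1 - a ≠ 0 := sub_ne_zero.2 ha1.symm
  have hfix : ∀ x, g x = x ↔ x = b / (1 - a) := by
    intro x
    rw [hab, eq_div_iff ha1']
    constructor <;> intro h <;> linear_combination -h
  set x₀ := b / (1 - a) with hx₀
  have hfixM : ∀ g' ∈ M, g' x₀ = x₀ := by
    intro g' hg'
    obtain ⟨a', b', hab'⟩ := haff g' hg'
    have hcomm := hslope _ (M.mul_mem hg hg') _ (M.mul_mem hg' hg) (a * a') (a * b' + b)
      (a' * b + b') (fun x => by rw [Equiv.Perm.mul_apply, hab, hab']; ring)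
      (fun x => by rw [Equiv.Perm.mul_apply, hab', hab]; ring)
    rw [← hfix, ← Equiv.Perm.mul_apply, hcomm, Equiv.Perm.mul_apply, (hfix x₀).2 rfl]
  have hx₀C : x₀ ∉ C := by
    intro h
    obtain ⟨g₁, hg₁, h₁⟩ := htr x₀ h c hc
    obtain ⟨g₂, hg₂, h₂⟩ := htr x₀ h c' hc'
    exact hcc (by rw [← h₁, ← h₂, hfixM g₁ hg₁, hfixM g₂ hg₂])
  refine ⟨x₀, hx₀C, hfixM, fun x hx y hy hxx₀ hyx₀ => ?_⟩
  have hcx₀ : c - x₀ ≠ 0 := sub_ne_zero.2 fun h => hx₀C (h ▸ hc)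
  have hmove : ∀ d ∈ C, ∃ g' ∈ M, g' x = x₀ + (d - x₀) / (c - x₀) * (x - x₀) := by
    intro d hd
    obtain ⟨g', hg', h'⟩ := htr c hc d hd
    obtain ⟨a', b', hab'⟩ := haff g' hg'
    refine ⟨g', hg', ?_⟩
    have h1 := hfixM g' hg'
    rw [hab'] at h1 h' ⊢
    have h2 : (d - x₀) / (c - x₀) = a' := by
      rw [div_eq_iff hcx₀]
      linear_combination h1 - h'
    rw [h2]
    linear_combination h1
  have hinv' : ∀ g' ∈ M, g' x ∉ C ∧ g' x ≠ x₀ := by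
    intro g' hg'
    refine ⟨fun h => hx ?_, fun h => hxx₀ (g'.injective (h.trans (hfixM g' hg').symm))⟩
    have := hinv _ (M.inv_mem hg') _ h
    rwa [← Equiv.Perm.mul_apply, inv_mul_cancel] at this
  have himage : C.image (fun d => x₀ + (d - x₀) / (c - x₀) * (x - x₀)) = (insert x₀ C)ᶜ := by
    refine Finset.eq_of_subset_of_card_le ?_ ?_
    · intro z hz
      obtain ⟨d, hd, rfl⟩ := Finset.mem_image.1 hz
      obtain ⟨g', hg', h'⟩ := hmove d hd
      have := hinv' g' hg'
      rw [h'] at this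
      simp only [Finset.mem_compl, Finset.mem_insert, not_or]
      exact this.symm
    · rw [Finset.card_compl, Finset.card_insert_of_notMem hx₀C, ZMod.card,
        Finset.card_image_of_injective]
      · omega
      · intro d d' h
        have h1 := mul_right_cancel₀ (sub_ne_zero.2 hxx₀) (add_left_cancel h)
        exact sub_left_injective ((div_left_inj' hcx₀).1 h1)
  have hy' : y ∈ (insert x₀ C)ᶜ := by simp [hy, hyx₀]
  rw [← himage] at hy'
  obtain ⟨d, hd, rfl⟩ := Finset.mem_image.1 hy'
  exact hmove d hd

theorem exists_affine_of_preserves {p : ℕ} [Fact p.Prime] {T : Finset (ZMod p)}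
    (h0 : 0 ∉ T) (hneg : ∀ t ∈ T, -t ∈ T) (hT : T.Nonempty) (hT' : ∃ s, s ≠ 0 ∧ s ∉ T)
    (g : ZMod p → ZMod p) (hg : Function.Injective g)
    (hgT : ∀ x y, y - x ∈ T ↔ g y - g x ∈ T) :
    ∃ a b, ∀ x, g x = a * x + b := by
  classical
  by_cases hcard : 2 * T.card < p
  · exact exists_affine_of_card_lt h0 hneg hT hcard g hg fun x t ht =>
      (hgT x (x + t)).1 (by simpa using ht)
  · have hmem : ∀ s, s ∈ (insert 0 T)ᶜ ↔ s ≠ 0 ∧ s ∉ T := by simp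
    have hneg' : ∀ t, -t ∈ T → t ∈ T := fun t ht => by simpa using hneg _ ht
    refine exists_affine_of_card_lt (S := (insert 0 T)ᶜ) (by simp) (fun t ht => ?_) ?_ ?_ g hg
      fun x t ht => ?_
    · rw [hmem] at ht ⊢
      exact ⟨neg_ne_zero.2 ht.1, fun h => ht.2 (hneg' t h)⟩
    · obtain ⟨s, hs⟩ := hT'
      exact ⟨s, (hmem s).2 hs⟩
    · rw [Finset.card_compl, Finset.card_insert_of_notMem h0, ZMod.card]
      have := (Fact.out : p.Prime).pos
      omega
    · rw [hmem] at ht ⊢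
      refine ⟨sub_ne_zero.2 fun h => ht.1 (by simpa using hg h), fun h => ht.2 ?_⟩
      simpa using (hgT x (x + t)).2 h

/-- A special case of Burnside's theorem: a transitive group of prime degree that preserves a
graph which is neither empty nor complete consists of affine maps. -/
theorem exists_affine_coordinates {X : Type*} [Fintype X] {p : ℕ} [Fact p.Prime]
    (hX : Fintype.card X = p) (M : Subgroup (Equiv.Perm X))
    (htr : ∀ x y, ∃ g ∈ M, g x = y) (L : SimpleGraph X)
    (hL : ∀ g ∈ M, ∀ x y, L.Adj (g x) (g y) ↔ L.Adj x y)
    (hbot : ∃ x y, L.Adj x y) (htop : ∃ x y, x ≠ y ∧ ¬ L.Adj x y) :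
    ∃ (e : ZMod p ≃ X) (T : Finset (ZMod p)), 0 ∉ T ∧ T.Nonempty ∧ (∃ s, s ≠ 0 ∧ s ∉ T) ∧
      (∀ x y, x ≠ y → (L.Adj (e x) (e y) ↔ y - x ∉ T)) ∧
      ∀ g ∈ M, ∃ a b, ∀ x, g (e x) = e (a * x + b) := by
  classical
  obtain ⟨σ, hσM, e, hσ⟩ := exists_cycle_coordinates hX M htr
  have hshift : ∀ (n : ℕ) x y, L.Adj (e (x + n)) (e (y + n)) ↔ L.Adj (e x) (e y) := by
    intro n
    induction n with
    | zero => simp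
    | succ n ih =>
      intro x y
      rw [← ih x y, Nat.cast_succ, ← add_assoc, ← add_assoc, ← hσ, ← hσ, hL σ hσM]
  have hdiff : ∀ x y, L.Adj (e x) (e y) ↔ L.Adj (e 0) (e (y - x)) := by
    intro x y
    rw [← hshift x.val 0 (y - x), ZMod.natCast_zmod_val, zero_add, sub_add_cancel]
  set T : Finset (ZMod p) := Finset.univ.filter fun t => t ≠ 0 ∧ ¬ L.Adj (e 0) (e t) with hTdef
  have hTmem : ∀ t, t ∈ T ↔ t ≠ 0 ∧ ¬ L.Adj (e 0) (e t) := by simp [hTdef]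
  have hadj : ∀ x y, x ≠ y → (L.Adj (e x) (e y) ↔ y - x ∉ T) := by
    intro x y hxy
    rw [hdiff, hTmem, not_and_not_right]
    exact ⟨fun h _ => h, fun h => h (sub_ne_zero.2 hxy.symm)⟩
  have h0 : 0 ∉ T := by simp [hTmem]
  have hneg : ∀ t ∈ T, -t ∈ T := by
    intro t ht
    have ht0 : t ≠ 0 := ((hTmem t).1 ht).1
    by_contra h
    have h1 := (hadj t 0 ht0).2 (by rwa [zero_sub])
    exact (hadj 0 t ht0.symm).1 h1.symm (by rwa [sub_zero])
  have hne : T.Nonempty := by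
    obtain ⟨x, y, hxy, h⟩ := htop
    refine ⟨e.symm y - e.symm x, ?_⟩
    by_contra h'
    have := (hadj (e.symm x) (e.symm y) (e.symm.injective.ne hxy)).2 h'
    exact h (by simpa using this)
  have hne' : ∃ s, s ≠ 0 ∧ s ∉ T := by
    obtain ⟨x, y, h⟩ := hbot
    have hxy : e.symm x ≠ e.symm y := e.symm.injective.ne h.ne
    exact ⟨e.symm y - e.symm x, sub_ne_zero.2 hxy.symm, (hadj _ _ hxy).1 (by simpa using h)⟩
  refine ⟨e, T, h0, hne, hne', hadj, fun g hg => ?_⟩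
  have hinj : Function.Injective fun x => e.symm (g (e x)) :=
    e.symm.injective.comp (g.injective.comp e.injective)
  obtain ⟨a, b, hab⟩ := exists_affine_of_preserves h0 hneg hne hne'
    (fun x => e.symm (g (e x))) hinj fun x y => by
      rcases eq_or_ne x y with rfl | hxy
      · simp
      · rw [← not_iff_not, ← hadj x y hxy, ← hadj _ _ (hinj.ne hxy), e.apply_symm_apply,
          e.apply_symm_apply, hL g hg]
  exact ⟨a, b, fun x => by rw [← hab x, e.apply_symm_apply]⟩

/-- Permutations of `X` induced along `f` by automorphisms fixing every vertex in `F`. -/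
def inducedPerms {V X : Type*} (Γ : SimpleGraph V) (f : X → V) (F : Set V) :
    Subgroup (Equiv.Perm X) where
  carrier := {g | ∃ φ : Γ ≃g Γ, (∀ z ∈ F, φ z = z) ∧ ∀ x, φ (f x) = f (g x)}
  mul_mem' := by
    rintro g g' ⟨φ, hφ, h⟩ ⟨φ', hφ', h'⟩
    exact ⟨φ'.trans φ, fun z hz => by simp [hφ' z hz, hφ z hz], fun x => by simp [h', h]⟩
  one_mem' := ⟨RelIso.refl _, fun _ _ => rfl, fun _ => rfl⟩
  inv_mem' := by
    rintro g ⟨φ, hφ, h⟩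
    refine ⟨φ.symm, fun z hz => ?_, fun x => ?_⟩
    · rw [RelIso.symm_apply_eq, hφ z hz]
    · rw [RelIso.symm_apply_eq, h, ← Equiv.Perm.mul_apply, mul_inv_cancel, Equiv.Perm.one_apply]

/-- An identification of the neighbours of `u` with `ZMod p` under which the graph induced on the
neighbours is the complement of a Cayley graph and automorphisms fixing `u` act affinely. -/
structure LocalCoordinates {V : Type*} (Γ : SimpleGraph V) (p : ℕ) (u : V) where
  e : ZMod p → V
  T : Finset (ZMod p)
  injective : Function.Injective e
  adj_center : ∀ w, Γ.Adj u w ↔ ∃ x, e x = w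
  zero_notMem : 0 ∉ T
  nonempty : T.Nonempty
  exists_notMem : ∃ s, s ≠ 0 ∧ s ∉ T
  adj_iff : ∀ x y, x ≠ y → (Γ.Adj (e x) (e y) ↔ y - x ∉ T)
  affine : ∀ φ : Γ ≃g Γ, φ u = u → ∃ a b, ∀ x, φ (e x) = e (a * x + b)

section

variable {V : Type*} {Γ : SimpleGraph V} {p : ℕ}

theorem eq_of_closed_under_adj (hconn : Γ.Connected) {P : V → Prop} {v : V} (hv : P v)
    (hP : ∀ x y, P x → Γ.Adj x y → P y) (y : V) : P y := by
  obtain ⟨q⟩ := hconn.preconnected v y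
  induction q with
  | nil => exact hv
  | cons h _ ih => exact ih (hP _ _ hv h)

theorem exists_is2Geodesic (hconn : Γ.Connected) (hnc : Γ ≠ ⊤) :
    ∃ v u w, Is2Geodesic Γ v u w := by
  by_contra! h
  refine hnc (SimpleGraph.ext ?_)
  ext v w
  rw [SimpleGraph.top_adj]
  refine ⟨fun h => h.ne, fun hvw => ?_⟩
  refine (eq_of_closed_under_adj hconn (P := fun y => v = y ∨ Γ.Adj v y) (Or.inl rfl)
    (fun x y hx hxy => ?_) w).resolve_left hvw
  rcases hx with rfl | hx
  · exact Or.inr hxy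
  · by_contra! hcon
    exact h v x y ⟨hx, hxy, hcon.1, hcon.2⟩

theorem exists_triangle (h2gt : TwoGeodesicTransitive Γ) (h2at : ¬ TwoArcTransitive Γ) :
    ∃ v u w, Γ.Adj v u ∧ Γ.Adj u w ∧ Γ.Adj v w := by
  by_contra! h
  exact h2at ⟨h2gt.1, fun v u w v' u' w' h1 h2 =>
    h2gt.2 ⟨h1.1, h1.2.1, h1.2.2, h v u w h1.1 h1.2.1⟩
      ⟨h2.1, h2.2.1, h2.2.2, h v' u' w' h2.1 h2.2.1⟩⟩

theorem is2Geodesic_apply_iff (φ : Γ ≃g Γ) {v u w : V} :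
    Is2Geodesic Γ (φ v) (φ u) (φ w) ↔ Is2Geodesic Γ v u w := by
  simp only [Is2Geodesic, φ.map_adj_iff, φ.injective.ne_iff]

namespace LocalCoordinates

variable {u : V} (L : LocalCoordinates Γ p u)

theorem adj_e (x : ZMod p) : Γ.Adj u (L.e x) := (L.adj_center _).2 ⟨x, rfl⟩

theorem neg_mem {t : ZMod p} (ht : t ∈ L.T) : -t ∈ L.T := by
  have ht0 : t ≠ 0 := fun h => L.zero_notMem (h ▸ ht)
  by_contra h
  have h1 := (L.adj_iff t 0 ht0).2 (by rwa [zero_sub])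
  exact (L.adj_iff 0 t ht0.symm).1 h1.symm (by rwa [sub_zero])

theorem is2Geodesic_iff {x y : ZMod p} : Is2Geodesic Γ (L.e x) u (L.e y) ↔ y - x ∈ L.T := by
  constructor
  · rintro ⟨-, -, hne, h⟩
    by_contra h'
    exact h ((L.adj_iff x y fun h => hne (h ▸ rfl)).2 h')
  · intro h
    have hxy : x ≠ y := by
      rintro rfl
      exact L.zero_notMem (by rwa [sub_self] at h)
    exact ⟨(L.adj_e x).symm, L.adj_e y, L.injective.ne hxy, fun h' => (L.adj_iff x y hxy).1 h' h⟩

variable [Fact p.Prime]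

theorem multipliers (h2gt : TwoGeodesicTransitive Γ) :
    ∀ t ∈ L.T, ∀ t' ∈ L.T, ∃ a, a * t = t' ∧ ∀ s, s ∈ L.T ↔ a * s ∈ L.T := by
  intro t ht t' ht'
  obtain ⟨φ, h0, hu, ht⟩ := h2gt.2 (L.is2Geodesic_iff.2 (by rwa [sub_zero] : t - 0 ∈ L.T))
    (L.is2Geodesic_iff.2 (by rwa [sub_zero] : t' - 0 ∈ L.T))
  obtain ⟨a, b, hab⟩ := L.affine φ hu
  have hb : b = 0 := by
    have := L.injective ((hab 0).symm.trans h0)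
    simpa using this
  subst hb
  simp only [add_zero] at hab
  refine ⟨a, L.injective ((hab t).symm.trans ht), fun s => ?_⟩
  have h := is2Geodesic_apply_iff φ (v := L.e 0) (u := u) (w := L.e s)
  rw [h0, hu, hab, L.is2Geodesic_iff, L.is2Geodesic_iff, sub_zero, sub_zero] at h
  exact h.symm

theorem card_lt : L.T.card + 1 < p := by
  obtain ⟨s, hs0, hs⟩ := L.exists_notMem
  have h1 : (insert s (insert 0 L.T)).card ≤ p :=
    (Finset.card_le_univ _).trans_eq (ZMod.card p)
  rw [Finset.card_insert_of_notMem (by simp [hs0, hs]),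
    Finset.card_insert_of_notMem L.zero_notMem] at h1
  exact h1

theorem le_card_filter (t : ZMod p) :
    p ≤ (Finset.univ.filter fun s => s ∉ L.T ∧ s - t ∉ L.T).card + 2 * L.T.card := by
  classical
  have h1 : (Finset.univ : Finset (ZMod p)) =
      (Finset.univ.filter fun s => s ∉ L.T ∧ s - t ∉ L.T) ∪ (L.T ∪ L.T.image fun s => s + t) := by
    ext s
    simp only [Finset.mem_univ, Finset.mem_union, Finset.mem_filter, true_and, Finset.mem_image,
      true_iff]
    by_cases hs : s ∈ L.T
    · exact Or.inr (Or.inl hs)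
    · by_cases hst : s - t ∈ L.T
      · exact Or.inr (Or.inr ⟨s - t, hst, sub_add_cancel s t⟩)
      · exact Or.inl ⟨hs, hst⟩
  have h2 := congrArg Finset.card h1
  rw [Finset.card_univ, ZMod.card] at h2
  have h3 := Finset.card_union_le (Finset.univ.filter fun s => s ∉ L.T ∧ s - t ∉ L.T)
    (L.T ∪ L.T.image fun s => s + t)
  have h4 := Finset.card_union_le L.T (L.T.image fun s => s + t)
  have h5 := Finset.card_image_le (s := L.T) (f := fun s => s + t)
  omega

theorem exists_perm {φ : Γ ≃g Γ} (hφ : φ u = u) :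
    ∃ g : Equiv.Perm (ZMod p), ∀ x, φ (L.e x) = L.e (g x) := by
  obtain ⟨a, b, hab⟩ := L.affine φ hφ
  have hinj : Function.Injective fun x => a * x + b := by
    intro x y hxy
    refine L.injective (φ.injective ?_)
    rw [hab, hab]
    exact congrArg L.e hxy
  exact ⟨Equiv.ofBijective _ (Finite.injective_iff_bijective.1 hinj), hab⟩

end LocalCoordinates

variable [Fintype V]

theorem exists_localCoordinates [Fact p.Prime]
    (hreg : ∀ v : V, Nat.card (Γ.neighborSet v) = p) (hconn : Γ.Connected) (hnc : Γ ≠ ⊤)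
    (h2gt : TwoGeodesicTransitive Γ) (h2at : ¬ TwoArcTransitive Γ) (u : V) :
    Nonempty (LocalCoordinates Γ p u) := by
  classical
  have hp : p.Prime := Fact.out
  have hX : Fintype.card (Γ.neighborSet u) = p := by rw [← Nat.card_eq_fintype_card, hreg]
  obtain ⟨⟨n, hn⟩⟩ : Nonempty (Γ.neighborSet u) := Fintype.card_pos_iff.1 (hX ▸ hp.pos)
  have hadj : ∀ φ : Γ ≃g Γ, ∀ x y, Γ.Adj (φ x) (φ y) ↔ Γ.Adj x y := fun φ x y => φ.map_adj_iff
  have hmove : ∀ φ : Γ ≃g Γ, φ u = u → ∃ g : Equiv.Perm (Γ.neighborSet u),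
      ∀ x : Γ.neighborSet u, φ x = g x := by
    intro φ hφ
    exact ⟨φ.toEquiv.subtypeEquiv fun a => by
      rw [SimpleGraph.mem_neighborSet, SimpleGraph.mem_neighborSet, ← hadj φ, hφ]; rfl,
      fun x => rfl⟩
  obtain ⟨e, T, h0, hne, hne', hT, haff⟩ := exists_affine_coordinates hX
    (inducedPerms Γ (Subtype.val : Γ.neighborSet u → V) {u})
    (fun x y => by
      obtain ⟨φ, hφ, hφ'⟩ := h2gt.1 x.2 y.2
      obtain ⟨g, hg⟩ := hmove φ hφ
      exact ⟨g, ⟨φ, by simpa using hφ, hg⟩, Subtype.ext (by rw [← hg, hφ'])⟩)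
    (Γ.comap Subtype.val)
    (by
      rintro g ⟨φ, -, hg⟩ x y
      rw [SimpleGraph.comap_adj, SimpleGraph.comap_adj, ← hg, ← hg, hadj])
    (by
      obtain ⟨v₁, u₁, w₁, h1, h2, h3⟩ := exists_triangle h2gt h2at
      obtain ⟨φ, hφ, -⟩ := h2gt.1 h2 hn
      refine ⟨⟨φ v₁, ?_⟩, ⟨φ w₁, ?_⟩, ?_⟩
      · rw [SimpleGraph.mem_neighborSet, ← hφ, hadj]
        exact h1.symm
      · rw [SimpleGraph.mem_neighborSet, ← hφ, hadj]
        exact h2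
      · rw [SimpleGraph.comap_adj, hadj]
        exact h3)
    (by
      obtain ⟨v₁, u₁, w₁, h1, h2, h3, h4⟩ := exists_is2Geodesic hconn hnc
      obtain ⟨φ, hφ, -⟩ := h2gt.1 h2 hn
      refine ⟨⟨φ v₁, ?_⟩, ⟨φ w₁, ?_⟩, ?_, ?_⟩
      · rw [SimpleGraph.mem_neighborSet, ← hφ, hadj]
        exact h1.symm
      · rw [SimpleGraph.mem_neighborSet, ← hφ, hadj]
        exact h2
      · exact fun h => h3 (φ.injective (Subtype.ext_iff.1 h))
      · rw [SimpleGraph.comap_adj, hadj]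
        exact h4)
  exact ⟨{
    e := fun x => e x
    T := T
    injective := Subtype.val_injective.comp e.injective
    adj_center := fun w => ⟨fun h => ⟨e.symm ⟨w, h⟩, by simp⟩, by
      rintro ⟨x, rfl⟩
      exact (e x).2⟩
    zero_notMem := h0
    nonempty := hne
    exists_notMem := hne'
    adj_iff := hT
    affine := fun φ hφ => by
      obtain ⟨g, hg⟩ := hmove φ hφ
      obtain ⟨a, b, hab⟩ := haff g ⟨φ, by simpa using hφ, hg⟩
      exact ⟨a, b, fun x => by rw [hg, hab]⟩ }⟩

open Classical in
/-- The neighbours of `v`. -/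
noncomputable def nbhd (Γ : SimpleGraph V) (v : V) : Finset V :=
  Finset.univ.filter fun w => Γ.Adj v w

open Classical in
/-- The vertices at distance two from `v`. -/
noncomputable def sphereTwo (Γ : SimpleGraph V) (v : V) : Finset V :=
  Finset.univ.filter fun w => w ≠ v ∧ ¬ Γ.Adj v w ∧ ∃ u, Γ.Adj v u ∧ Γ.Adj u w

theorem mem_nbhd {v w : V} : w ∈ nbhd Γ v ↔ Γ.Adj v w := by simp [nbhd]

theorem mem_sphereTwo {v w : V} :
    w ∈ sphereTwo Γ v ↔ w ≠ v ∧ ¬ Γ.Adj v w ∧ ∃ u, Γ.Adj v u ∧ Γ.Adj u w := by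
  simp [sphereTwo]

theorem Is2Geodesic.mem_sphereTwo {v u w : V} (h : Is2Geodesic Γ v u w) : w ∈ sphereTwo Γ v :=
  _root_.mem_sphereTwo.2 ⟨h.2.2.1.symm, h.2.2.2, u, h.1, h.2.1⟩

theorem is2Geodesic_of_mem {v u w : V} (hvu : Γ.Adj v u) (huw : Γ.Adj u w)
    (hw : w ∈ sphereTwo Γ v) : Is2Geodesic Γ v u w :=
  ⟨hvu, huw, (mem_sphereTwo.1 hw).1.symm, (mem_sphereTwo.1 hw).2.1⟩

theorem apply_mem_nbhd (φ : Γ ≃g Γ) {v w : V} : φ w ∈ nbhd Γ (φ v) ↔ w ∈ nbhd Γ v := by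
  rw [mem_nbhd, mem_nbhd, φ.map_adj_iff]

theorem apply_mem_sphereTwo (φ : Γ ≃g Γ) {v w : V} :
    φ w ∈ sphereTwo Γ (φ v) ↔ w ∈ sphereTwo Γ v := by
  rw [mem_sphereTwo, mem_sphereTwo, φ.injective.ne_iff, φ.map_adj_iff,
    φ.surjective.exists]
  simp only [φ.map_adj_iff]

theorem card_nbhd (hreg : ∀ v : V, Nat.card (Γ.neighborSet v) = p) (v : V) :
    (nbhd Γ v).card = p := by
  classical
  rw [← hreg v, ← Nat.card_eq_finsetCard]
  exact Nat.card_congr (Equiv.subtypeEquivRight fun w => mem_nbhd)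

namespace LocalCoordinates

variable {u : V} (L : LocalCoordinates Γ p u)

theorem card_nbhd_inter_sphereTwo [DecidableEq V] (x : ZMod p) :
    (nbhd Γ u ∩ sphereTwo Γ (L.e x)).card = L.T.card := by
  refine (Finset.card_nbij (fun t => L.e (x + t)) ?_ ?_ ?_).symm
  · intro t ht
    have h : Is2Geodesic Γ (L.e x) u (L.e (x + t)) := L.is2Geodesic_iff.2 (by simpa using ht)
    simp only [Finset.coe_inter, Set.mem_inter_iff, Finset.mem_coe]
    exact ⟨mem_nbhd.2 h.2.1, h.mem_sphereTwo⟩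
  · exact (L.injective.comp (add_right_injective x)).injOn
  · intro w hw
    simp only [Finset.coe_inter, Set.mem_inter_iff, Finset.mem_coe] at hw
    obtain ⟨y, rfl⟩ := (L.adj_center w).1 (mem_nbhd.1 hw.1)
    refine ⟨y - x, ?_, by simp⟩
    exact L.is2Geodesic_iff.1 (is2Geodesic_of_mem (L.adj_e x).symm (L.adj_e y) hw.2)

variable [Fact p.Prime]

theorem card_common_lt [DecidableEq V] (hreg : ∀ v : V, Nat.card (Γ.neighborSet v) = p)
    {t : ZMod p} (ht : t ∈ L.T) : (nbhd Γ (L.e 0) ∩ nbhd Γ (L.e t)).card < p := by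
  by_contra! h
  have heq : nbhd Γ (L.e 0) = nbhd Γ (L.e t) := by
    have h1 := Finset.eq_of_subset_of_card_le
      (Finset.inter_subset_left (s₁ := nbhd Γ (L.e 0)) (s₂ := nbhd Γ (L.e t)))
      (by rwa [card_nbhd hreg])
    have h2 := Finset.eq_of_subset_of_card_le
      (Finset.inter_subset_right (s₁ := nbhd Γ (L.e 0)) (s₂ := nbhd Γ (L.e t)))
      (by rwa [card_nbhd hreg])
    exact h1.symm.trans h2
  have hmem : ∀ x y, y - x ∈ insert 0 L.T ↔ L.e y ∉ nbhd Γ (L.e x) := by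
    intro x y
    rw [mem_nbhd, Finset.mem_insert]
    rcases eq_or_ne x y with rfl | hxy
    · simp
    · rw [L.adj_iff x y hxy, not_not, or_iff_right (sub_ne_zero.2 hxy.symm)]
  have h0 : -t = 0 := by
    refine translation_subset_eq_zero (C := insert 0 L.T) ⟨0, Finset.mem_insert_self _ _⟩ ?_ ?_
    · rw [Finset.card_insert_of_notMem L.zero_notMem]
      exact L.card_lt
    · intro x hx
      rw [← sub_eq_add_neg, hmem, ← heq, ← hmem, sub_zero]
      exact hx
  exact L.zero_notMem (neg_eq_zero.1 h0 ▸ ht)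

theorem card_filter_succ_le [DecidableEq V] {t : ZMod p} (ht : t ∈ L.T) :
    (Finset.univ.filter fun s => s ∉ L.T ∧ s - t ∉ L.T).card + 1 ≤
      (nbhd Γ (L.e 0) ∩ nbhd Γ (L.e t)).card := by
  have hu : u ∉ (Finset.univ.filter fun s => s ∉ L.T ∧ s - t ∉ L.T).image L.e := by
    intro h
    obtain ⟨s, -, hs⟩ := Finset.mem_image.1 h
    exact (L.adj_e s).ne hs.symm
  rw [← Finset.card_image_of_injective _ L.injective, ← Finset.card_insert_of_notMem hu]
  refine Finset.card_le_card fun w hw => ?_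
  rw [Finset.mem_inter, mem_nbhd, mem_nbhd]
  rcases Finset.mem_insert.1 hw with rfl | hw
  · exact ⟨(L.adj_e 0).symm, (L.adj_e t).symm⟩
  · obtain ⟨s, hs, rfl⟩ := Finset.mem_image.1 hw
    obtain ⟨hs, hst⟩ := (Finset.mem_filter.1 hs).2
    have hs0 : (0 : ZMod p) ≠ s := by
      rintro rfl
      exact hst (by simpa using L.neg_mem ht)
    have hts : t ≠ s := by
      rintro rfl
      exact hs ht
    exact ⟨(L.adj_iff 0 s hs0).2 (by rwa [sub_zero]), (L.adj_iff t s hts).2 hst⟩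

end LocalCoordinates

theorem card_T_eq_card_T (h2gt : TwoGeodesicTransitive Γ) {u u' : V}
    (L : LocalCoordinates Γ p u) (L' : LocalCoordinates Γ p u') : L.T.card = L'.T.card := by
  classical
  obtain ⟨φ, h1, h2⟩ := h2gt.1 (L.adj_e 0).symm (L'.adj_e 0).symm
  rw [← L.card_nbhd_inter_sphereTwo 0, ← L'.card_nbhd_inter_sphereTwo 0]
  refine Finset.card_bijective φ φ.bijective fun w => ?_
  rw [← h1, ← h2, Finset.mem_inter, Finset.mem_inter, apply_mem_nbhd, apply_mem_sphereTwo]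

theorem card_common_eq_card_common [DecidableEq V] (h2gt : TwoGeodesicTransitive Γ)
    {v w v' w' : V} (hw : w ∈ sphereTwo Γ v) (hw' : w' ∈ sphereTwo Γ v') :
    (nbhd Γ v ∩ nbhd Γ w).card = (nbhd Γ v' ∩ nbhd Γ w').card := by
  obtain ⟨u, h1, h2⟩ := (mem_sphereTwo.1 hw).2.2
  obtain ⟨u', h1', h2'⟩ := (mem_sphereTwo.1 hw').2.2
  obtain ⟨φ, hv, -, hw⟩ := h2gt.2 (is2Geodesic_of_mem h1 h2 hw) (is2Geodesic_of_mem h1' h2' hw')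
  refine Finset.card_bijective φ φ.bijective fun z => ?_
  rw [← hv, ← hw, Finset.mem_inter, Finset.mem_inter, apply_mem_nbhd, apply_mem_nbhd]

theorem exists_parameters [DecidableEq V] [Fact p.Prime]
    (hreg : ∀ v : V, Nat.card (Γ.neighborSet v) = p)
    (hconn : Γ.Connected) (h2gt : TwoGeodesicTransitive Γ)
    (hL : ∀ u, Nonempty (LocalCoordinates Γ p u)) :
    ∃ h, 2 * h + 1 = p ∧ 2 ≤ h ∧ Even h ∧
      (∀ v w, w ∈ sphereTwo Γ v → (nbhd Γ v ∩ nbhd Γ w).card = h) ∧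
      (∀ v, (sphereTwo Γ v).card = p) ∧
      ∀ v w, w ∈ sphereTwo Γ v → ((nbhd Γ w).filter fun y => y ∈ sphereTwo Γ v).Nonempty := by
  obtain ⟨u₀⟩ := hconn.nonempty
  obtain ⟨L₀⟩ := hL u₀
  set h := L₀.T.card with hh
  obtain ⟨t₀, ht₀⟩ := L₀.nonempty
  have hgeo₀ : Is2Geodesic Γ (L₀.e 0) u₀ (L₀.e t₀) := L₀.is2Geodesic_iff.2 (by rwa [sub_zero])
  set c := (nbhd Γ (L₀.e 0) ∩ nbhd Γ (L₀.e t₀)).card with hc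
  have hc' : ∀ v w, w ∈ sphereTwo Γ v → (nbhd Γ v ∩ nbhd Γ w).card = c := fun v w hw =>
    card_common_eq_card_common h2gt hw hgeo₀.mem_sphereTwo
  have hcount : ∀ v, p * h = (sphereTwo Γ v).card * c := by
    intro v
    rw [← card_nbhd hreg v]
    classical
    refine Finset.card_mul_eq_card_mul Γ.Adj (fun u hu => ?_) fun w hw => ?_
    · obtain ⟨L⟩ := hL u
      obtain ⟨x, rfl⟩ := (L.adj_center v).1 (mem_nbhd.1 hu).symm
      rw [hh, card_T_eq_card_T h2gt L₀ L, ← L.card_nbhd_inter_sphereTwo x]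
      congr 1
      ext w
      simp [Finset.bipartiteAbove, mem_nbhd, and_comm]
    · rw [← hc' v w hw]
      congr 1
      ext u
      simp [Finset.bipartiteBelow, mem_nbhd, Γ.adj_comm w u]
  have hp : p.Prime := Fact.out
  have hpos : 0 < h := Finset.card_pos.2 ⟨t₀, ht₀⟩
  have hcp : c < p := L₀.card_common_lt hreg ht₀
  have hμc := L₀.card_filter_succ_le ht₀
  rw [← hc] at hμc
  have hch : c ∣ h := by
    exact (Nat.coprime_of_lt_prime (by omega) hcp hp).symm.dvd_of_dvd_mul_left
      (hcount u₀ ▸ Dvd.intro_left _ rfl)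
  have hhp : 2 * h + 1 = p := by
    have h1 := L₀.le_card_filter t₀
    have h2 := Nat.le_of_dvd hpos hch
    have h3 := L₀.card_lt
    obtain ⟨k, hk⟩ := card_dvd_of_multipliers L₀.zero_notMem L₀.nonempty (L₀.multipliers h2gt)
    rw [← hh] at h1 h3 hk
    have hk2 : k = 2 := by
      by_contra hne
      rcases lt_or_gt_of_ne hne with hlt | hgt
      · have : h * k ≤ h * 1 := Nat.mul_le_mul_left _ (by omega)
        omega
      · have : h * 3 ≤ h * k := Nat.mul_le_mul_left _ (by omega)
        omega
    subst hk2
    omega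
  have hpaley : ∀ u (L : LocalCoordinates Γ p u), ∀ t ∈ L.T,
      2 * (Finset.univ.filter fun s => s ∉ L.T ∧ s - t ∉ L.T).card = h := by
    intro u L t ht
    rw [hh, card_T_eq_card_T h2gt L₀ L]
    exact two_mul_card_compl_eq L.zero_notMem (fun _ => L.neg_mem)
      (by rw [card_T_eq_card_T h2gt L L₀]; exact hhp) (L.multipliers h2gt) ht
  have hμ := hpaley u₀ L₀ t₀ ht₀
  have hceq : c = h := by
    obtain ⟨k, hk⟩ := hch
    rcases Nat.lt_or_ge k 2 with hk2 | hk2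
    · interval_cases k <;> omega
    · have : c * 2 ≤ c * k := Nat.mul_le_mul_left _ hk2
      omega
  refine ⟨h, hhp, by omega, ⟨_, by rw [← hμ, two_mul]⟩, fun v w hw => (hc' v w hw).trans hceq,
    fun v => ?_, fun v w hw => ?_⟩
  · have := hcount v
    rw [hceq] at this
    exact (Nat.eq_of_mul_eq_mul_right hpos this).symm
  · obtain ⟨u, h1, h2⟩ := (mem_sphereTwo.1 hw).2.2
    obtain ⟨L⟩ := hL u
    obtain ⟨x, rfl⟩ := (L.adj_center v).1 h1.symm
    obtain ⟨y, rfl⟩ := (L.adj_center w).1 h2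
    have hxy := L.is2Geodesic_iff.1 (is2Geodesic_of_mem h1 h2 hw)
    have hμ' := hpaley u L (y - x) hxy
    have hTcard : L.T.card = h := card_T_eq_card_T h2gt L L₀
    by_contra hemp
    rw [Finset.not_nonempty_iff_eq_empty, Finset.filter_eq_empty_iff] at hemp
    have hsub : (insert (y - x) (L.T.image fun s => s + (y - x)))ᶜ ⊆
        Finset.univ.filter fun s => s ∉ L.T ∧ s - (y - x) ∉ L.T := by
      intro s hs
      rw [Finset.mem_compl, Finset.mem_insert, Finset.mem_image, not_or] at hs
      have hsT : s - (y - x) ∉ L.T := fun h => hs.2 ⟨_, h, sub_add_cancel s _⟩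
      refine Finset.mem_filter.2 ⟨Finset.mem_univ s, fun hsT' => ?_, hsT⟩
      have hadj : Γ.Adj (L.e y) (L.e (x + s)) := by
        refine (L.adj_iff _ _ fun h => hs.1 ?_).2 ?_
        · rw [h, add_sub_cancel_left]
        · rwa [show x + s - y = s - (y - x) by ring]
      refine hemp (mem_nbhd.2 hadj) ?_
      exact (L.is2Geodesic_iff.2 (by rwa [add_sub_cancel_left])).mem_sphereTwo
    have h1 := Finset.card_le_card hsub
    rw [Finset.card_compl, ZMod.card] at h1
    have h2 := Finset.card_insert_le (y - x) (L.T.image fun s => s + (y - x))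
    have h3 := Finset.card_image_le (s := L.T) (f := fun s => s + (y - x))
    omega

theorem even_card_of_odd_card_sphereTwo [DecidableEq V] (h2gt : TwoGeodesicTransitive Γ) {v w : V}
    (hodd : Odd (sphereTwo Γ v).card) (hw : w ∈ sphereTwo Γ v) :
    Even ((nbhd Γ w).filter fun y => y ∈ sphereTwo Γ v).card := by
  classical
  set D : V → Finset V := fun w => (nbhd Γ w).filter fun y => y ∈ sphereTwo Γ v with hD
  have hDcard : ∀ w' ∈ sphereTwo Γ v, (D w').card = (D w).card := by
    intro w' hw'
    obtain ⟨u, h1, h2⟩ := (mem_sphereTwo.1 hw).2.2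
    obtain ⟨u', h1', h2'⟩ := (mem_sphereTwo.1 hw').2.2
    obtain ⟨φ, hv, -, hφw⟩ :=
      h2gt.2 (is2Geodesic_of_mem h1' h2' hw') (is2Geodesic_of_mem h1 h2 hw)
    refine Finset.card_bijective φ φ.bijective fun z => ?_
    rw [hD, Finset.mem_filter, Finset.mem_filter, ← hφw, apply_mem_nbhd]
    have h := apply_mem_sphereTwo φ (v := v) (w := z)
    rw [hv] at h
    rw [h]
  set G := Γ.comap (Subtype.val : sphereTwo Γ v → V) with hG
  have hdeg : ∀ x : sphereTwo Γ v, G.degree x = (D w).card := by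
    intro x
    rw [← hDcard x x.2, ← SimpleGraph.card_neighborFinset_eq_degree]
    refine Finset.card_nbij Subtype.val ?_ Subtype.val_injective.injOn ?_
    · intro y hy
      simpa [hG, hD, mem_nbhd] using hy
    · intro y hy
      have hy' : y ∈ nbhd Γ x ∧ y ∈ sphereTwo Γ v := by simpa [hD] using hy
      exact ⟨⟨y, hy'.2⟩, by simpa [hG] using mem_nbhd.1 hy'.1, rfl⟩
  by_contra hcon
  rw [Nat.not_even_iff_odd] at hcon
  have h1 := G.even_card_odd_degree_vertices
  rw [Finset.filter_true_of_mem fun x _ => by rwa [hdeg], Finset.card_univ,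
    Fintype.card_coe] at h1
  exact (Nat.not_even_iff_odd.2 hodd) h1

theorem exists_antipodal_neighbor [DecidableEq V] [Fact p.Prime]
    (h2gt : TwoGeodesicTransitive Γ) {v w : V} (L : LocalCoordinates Γ p w) {h : ℕ} (hhp : 2 * h + 1 = p) (hh2 : 2 ≤ h)
    (hheven : Even h) (hodd : Odd (sphereTwo Γ v).card) (hw : w ∈ sphereTwo Γ v)
    (hc : ((nbhd Γ w).filter fun y => y ∈ nbhd Γ v).card = h)
    (hne : ((nbhd Γ w).filter fun y => y ∈ sphereTwo Γ v).Nonempty) :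
    ∃ x, Γ.Adj w x ∧ x ≠ v ∧ ¬ Γ.Adj v x ∧ x ∉ sphereTwo Γ v ∧
      (∀ y, Γ.Adj w y → Γ.Adj v y ∨ y ∈ sphereTwo Γ v ∨ y = x) ∧
      (∀ y, Γ.Adj w y → y ∈ sphereTwo Γ v → Γ.Adj x y) ∧
      ((nbhd Γ w).filter fun y => y ∈ sphereTwo Γ v).card = h := by
  have himage : ∀ (P : V → Prop) [DecidablePred P], ((nbhd Γ w).filter P).card =
      (Finset.univ.filter fun x => P (L.e x)).card := by
    intro P _
    rw [← Finset.card_image_of_injective _ L.injective]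
    congr 1
    ext y
    simp only [Finset.mem_filter, mem_nbhd, L.adj_center, Finset.mem_image, Finset.mem_univ,
      true_and]
    constructor
    · rintro ⟨⟨x, rfl⟩, hx⟩
      exact ⟨x, hx, rfl⟩
    · rintro ⟨x, hx, rfl⟩
      exact ⟨⟨x, rfl⟩, hx⟩
  have hDeven := even_card_of_odd_card_sphereTwo h2gt hodd hw
  rw [himage] at hc hDeven
  set C := Finset.univ.filter fun x => L.e x ∈ nbhd Γ v with hC
  set D := Finset.univ.filter fun x => L.e x ∈ sphereTwo Γ v with hD
  have hCmem : ∀ x, x ∈ C ↔ Γ.Adj v (L.e x) := by simp [hC, mem_nbhd]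
  have hDmem : ∀ x, x ∈ D ↔ L.e x ∈ sphereTwo Γ v := by simp [hD]
  set M := inducedPerms Γ L.e {v, w} with hM
  have hMφ : ∀ g ∈ M, ∃ φ : Γ ≃g Γ, φ v = v ∧ φ w = w ∧ ∀ x, φ (L.e x) = L.e (g x) := by
    rintro g ⟨φ, hφ, hg⟩
    exact ⟨φ, hφ v (by simp), hφ w (by simp), hg⟩
  obtain ⟨x₀, hx₀C, hx₀M, hMtr⟩ := affine_orbits M
    (by
      intro g hg
      obtain ⟨φ, -, hφw, hφ⟩ := hMφ g hg
      obtain ⟨a, b, hab⟩ := L.affine φ hφw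
      exact ⟨a, b, fun x => L.injective ((hφ x).symm.trans (hab x))⟩)
    (C := C)
    (by
      intro x hx y hy
      obtain ⟨φ, hφv, hφx, hφw⟩ := h2gt.2
        (is2Geodesic_of_mem ((hCmem x).1 hx) (L.adj_e x).symm hw)
        (is2Geodesic_of_mem ((hCmem y).1 hy) (L.adj_e y).symm hw)
      obtain ⟨g, hg⟩ := L.exists_perm hφw
      exact ⟨g, ⟨φ, by simp [hφv, hφw], hg⟩, L.injective ((hg x).symm.trans hφx)⟩)
    (by
      intro g hg x hx
      obtain ⟨φ, hφv, -, hφ⟩ := hMφ g hg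
      rw [hCmem] at hx ⊢
      rw [← hφ, ← hφv, φ.map_adj_iff]
      exact hx)
    (by omega) (by omega)
  have hDM : ∀ g ∈ M, ∀ x, x ∈ D → g x ∈ D := by
    intro g hg x hx
    obtain ⟨φ, hφv, -, hφ⟩ := hMφ g hg
    rw [hDmem] at hx ⊢
    rw [← hφ, ← hφv, apply_mem_sphereTwo]
    exact hx
  have hDC : ∀ x ∈ D, x ∉ C := fun x hx hx' =>
    (mem_sphereTwo.1 ((hDmem x).1 hx)).2.1 ((hCmem x).1 hx')
  have hDall : ∀ z ∈ D, z ≠ x₀ → ∀ y ∉ C, y ≠ x₀ → y ∈ D := by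
    intro z hz hzx₀ y hy hyx₀
    obtain ⟨g, hg, rfl⟩ := hMtr z (hDC z hz) y hy hzx₀ hyx₀
    exact hDM g hg z hz
  have hx₀D : x₀ ∉ D := by
    intro hx₀
    by_cases hz : ∃ z ∈ D, z ≠ x₀
    · obtain ⟨z, hz, hzx₀⟩ := hz
      have hDeq : D = Cᶜ := by
        ext y
        rw [Finset.mem_compl]
        refine ⟨hDC y, fun hy => ?_⟩
        rcases eq_or_ne y x₀ with rfl | hyx₀
        · exact hx₀
        · exact hDall z hz hzx₀ y hy hyx₀
      rw [hDeq, Finset.card_compl, ZMod.card, hc] at hDeven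
      rw [Nat.even_iff] at hDeven hheven
      omega
    · push Not at hz
      rw [Finset.eq_singleton_iff_unique_mem.2 ⟨hx₀, hz⟩] at hDeven
      simp at hDeven
  obtain ⟨z, hz⟩ : D.Nonempty := by
    obtain ⟨y, hy⟩ := hne
    obtain ⟨hy1, hy2⟩ := Finset.mem_filter.1 hy
    obtain ⟨x, rfl⟩ := (L.adj_center y).1 (mem_nbhd.1 hy1)
    exact ⟨x, (hDmem x).2 hy2⟩
  have hDiff : ∀ y, y ∈ D ↔ y ∉ C ∧ y ≠ x₀ := fun y =>
    ⟨fun hy => ⟨hDC y hy, fun h => hx₀D (h ▸ hy)⟩,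
      fun hy => hDall z hz (fun h => hx₀D (h ▸ hz)) y hy.1 hy.2⟩
  have hvx₀ : L.e x₀ ≠ v := by
    intro hv
    have := L.adj_e x₀
    rw [hv] at this
    exact (mem_sphereTwo.1 hw).2.1 this.symm
  have hvx₀' : ¬ Γ.Adj v (L.e x₀) := fun h => hx₀C ((hCmem x₀).2 h)
  refine ⟨L.e x₀, L.adj_e x₀, hvx₀, hvx₀', fun h => hx₀D ((hDmem x₀).2 h), ?_, ?_, ?_⟩
  · intro y hy
    obtain ⟨y, rfl⟩ := (L.adj_center y).1 hy
    rw [← hCmem, ← hDmem, hDiff, L.injective.eq_iff]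
    tauto
  · intro y hwy hy
    obtain ⟨y, rfl⟩ := (L.adj_center y).1 hwy
    rw [← hDmem, hDiff] at hy
    obtain ⟨s, hs0, hs⟩ := L.exists_notMem
    have hadj : Γ.Adj (L.e x₀) (L.e (x₀ + s)) :=
      (L.adj_iff _ _ (by simpa using hs0)).2 (by rwa [add_sub_cancel_left])
    have hsC : x₀ + s ∉ C := fun h => hx₀D ((hDmem x₀).2
      (mem_sphereTwo.2 ⟨hvx₀, hvx₀', _, (hCmem _).1 h, hadj.symm⟩))
    obtain ⟨g, hg, hgy⟩ := hMtr (x₀ + s) hsC y hy.1 (by simpa using hs0) hy.2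
    obtain ⟨φ, -, -, hφ⟩ := hMφ g hg
    rw [← φ.map_adj_iff, hφ, hφ, hx₀M g hg, hgy] at hadj
    exact hadj
  · have hDeq : D = (insert x₀ C)ᶜ := by
      ext y
      rw [hDiff, Finset.mem_compl, Finset.mem_insert]
      tauto
    rw [himage]
    change D.card = h
    rw [hDeq, Finset.card_compl, ZMod.card, Finset.card_insert_of_notMem hx₀C]
    omega

theorem exists_antipode [Fact p.Prime]
    (hreg : ∀ v : V, Nat.card (Γ.neighborSet v) = p)
    (hconn : Γ.Connected) (h2gt : TwoGeodesicTransitive Γ)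
    (hL : ∀ u, Nonempty (LocalCoordinates Γ p u)) (v : V) :
    ∃ x, x ≠ v ∧ ¬ Γ.Adj v x ∧ x ∉ sphereTwo Γ v ∧ (∃ w ∈ sphereTwo Γ v, Γ.Adj w x) ∧
      ∀ y, y = v ∨ Γ.Adj v y ∨ y ∈ sphereTwo Γ v ∨ y = x := by
  classical
  obtain ⟨h, hhp, hh2, hheven, hc, hcard, hne⟩ := exists_parameters hreg hconn h2gt hL
  have hodd : Odd (sphereTwo Γ v).card := ⟨h, by rw [hcard, hhp]⟩
  set D : V → Finset V := fun w => (nbhd Γ w).filter fun y => y ∈ sphereTwo Γ v with hD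
  have hex : ∀ w ∈ sphereTwo Γ v, ∃ x, Γ.Adj w x ∧ x ≠ v ∧ ¬ Γ.Adj v x ∧ x ∉ sphereTwo Γ v ∧
      (∀ y, Γ.Adj w y → Γ.Adj v y ∨ y ∈ sphereTwo Γ v ∨ y = x) ∧
      (∀ y, Γ.Adj w y → y ∈ sphereTwo Γ v → Γ.Adj x y) ∧ (D w).card = h := by
    intro w hw
    obtain ⟨L⟩ := hL w
    refine exists_antipodal_neighbor h2gt L hhp hh2 hheven hodd hw ?_ (hne v w hw)
    rw [← hc v w hw]
    congr 1
    ext y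
    simp [and_comm]
  obtain ⟨w₀, hw₀⟩ : (sphereTwo Γ v).Nonempty := Finset.card_pos.1 (by rw [hcard]; omega)
  obtain ⟨x, hwx, hxv, hvx, hx, -, hDx, hDcard⟩ := hex w₀ hw₀
  have hsub : ∀ w ∈ sphereTwo Γ v, insert w (D w) ⊆ sphereTwo Γ v := by
    intro w hw y hy
    rcases Finset.mem_insert.1 hy with rfl | hy
    · exact hw
    · exact (Finset.mem_filter.1 hy).2
  have hins : ∀ w, (D w).card = h → (insert w (D w)).card = h + 1 := by
    intro w hw
    rw [Finset.card_insert_of_notMem, hw]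
    intro h
    exact (mem_nbhd.1 (Finset.mem_filter.1 h).1).ne rfl
  have hall : ∀ w ∈ sphereTwo Γ v,
      Γ.Adj w x ∧ ∀ y, Γ.Adj w y → Γ.Adj v y ∨ y ∈ sphereTwo Γ v ∨ y = x := by
    intro w hw
    obtain ⟨x', hwx', hxv', hvx', hx', hcov', hDx', hDcard'⟩ := hex w hw
    have hinter : ¬ Disjoint (insert w₀ (D w₀)) (insert w (D w)) := by
      intro hdisj
      have h1 := Finset.card_le_card (Finset.union_subset (hsub w₀ hw₀) (hsub w hw))
      rw [Finset.card_union_of_disjoint hdisj, hins _ hDcard, hins _ hDcard', hcard] at h1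
      omega
    obtain ⟨z, hz, hz'⟩ := Finset.not_disjoint_iff.1 hinter
    obtain ⟨x'', -, -, -, -, hcov, -, -⟩ := hex z (hsub w hw hz')
    have hzx : Γ.Adj z x := by
      rcases Finset.mem_insert.1 hz with rfl | hz
      · exact hwx
      · exact (hDx z (mem_nbhd.1 (Finset.mem_filter.1 hz).1) (Finset.mem_filter.1 hz).2).symm
    have hzx' : Γ.Adj z x' := by
      rcases Finset.mem_insert.1 hz' with rfl | hz'
      · exact hwx'
      · exact (hDx' z (mem_nbhd.1 (Finset.mem_filter.1 hz').1) (Finset.mem_filter.1 hz').2).symm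
    have h1 : x = x'' := ((hcov x hzx).resolve_left hvx).resolve_left hx
    have h2 : x' = x'' := ((hcov x' hzx').resolve_left hvx').resolve_left hx'
    obtain rfl : x' = x := h2.trans h1.symm
    exact ⟨hwx', hcov'⟩
  have hnx : sphereTwo Γ v = nbhd Γ x := by
    refine Finset.eq_of_subset_of_card_le (fun w hw => mem_nbhd.2 (hall w hw).1.symm) ?_
    rw [card_nbhd hreg, hcard]
  refine ⟨x, hxv, hvx, hx, ⟨w₀, hw₀, hwx⟩, ?_⟩
  refine eq_of_closed_under_adj hconn (v := v) (Or.inl rfl) fun a b ha hab => ?_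
  rcases ha with rfl | ha | ha | rfl
  · exact Or.inr (Or.inl hab)
  · by_cases hb : b = v ∨ Γ.Adj v b
    · tauto
    · rw [not_or] at hb
      exact Or.inr (Or.inr (Or.inl (mem_sphereTwo.2 ⟨hb.1, hb.2, a, ha, hab⟩)))
  · exact Or.inr ((hall a ha).2 b hab)
  · exact Or.inr (Or.inr (Or.inl (hnx ▸ mem_nbhd.2 hab)))

end

theorem stmt13 {V : Type*} [Fintype V] (Γ : SimpleGraph V) (p : ℕ)
    (hp : p.Prime)
    (hreg : ∀ v : V, Nat.card (Γ.neighborSet v) = p)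
    (hconn : Γ.Connected)
    (hnc : Γ ≠ ⊤)
    (h2gt : TwoGeodesicTransitive Γ)
    (h2at : ¬ TwoArcTransitive Γ) :
    Γ.diam = 3 ∧
    ∀ i : ℕ, 1 ≤ i → i ≤ 3 →
      ∀ f g : ℕ → V, IsIGeodesic Γ i f → IsIGeodesic Γ i g →
        ∃ φ : Γ ≃g Γ, ∀ j ≤ i, φ (f j) = g j := by
  have : Fact p.Prime := ⟨hp⟩
  have hanti := exists_antipode hreg hconn h2gt
    (exists_localCoordinates hreg hconn hnc h2gt h2at)
  have hfar : ∀ v x, 3 ≤ Γ.dist v x → x ≠ v ∧ ¬ Γ.Adj v x ∧ x ∉ sphereTwo Γ v := by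
    intro v x h
    refine ⟨?_, fun h' => ?_, fun h' => ?_⟩
    · rintro rfl
      simp at h
    · rw [SimpleGraph.dist_eq_one_iff_adj.2 h'] at h
      omega
    · obtain ⟨u, h1, h2⟩ := (mem_sphereTwo.1 h').2.2
      have := SimpleGraph.dist_le (Walk.cons h1 (Walk.cons h2 Walk.nil))
      simp at this
      omega
  have hunique : ∀ v x y, 3 ≤ Γ.dist v x → 3 ≤ Γ.dist v y → x = y := by
    intro v x y hx hy
    obtain ⟨z, -, -, -, -, hz⟩ := hanti v
    have key : ∀ y, 3 ≤ Γ.dist v y → y = z := fun y hy => by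
      have := hfar v y hy
      have := hz y
      tauto
    rw [key x hx, key y hy]
  have hnotfar : ∀ v x, x ≠ v → ¬ Γ.Adj v x → x ∉ sphereTwo Γ v → 3 ≤ Γ.dist v x := by
    intro v x h1 h2 h3
    obtain ⟨q, hq⟩ := hconn.exists_walk_length_eq_dist v x
    rw [← hq]
    match q with
    | .nil => exact absurd rfl h1
    | .cons h .nil => exact absurd h h2
    | .cons h (.cons h' .nil) => exact absurd (mem_sphereTwo.2 ⟨h1, h2, _, h, h'⟩) h3
    | .cons _ (.cons _ (.cons _ _)) => simp
  have hle : ∀ v y, Γ.dist v y ≤ 3 := by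
    intro v y
    by_contra! hlt
    obtain ⟨x, h1, h2, h3, ⟨w, hw, hwx⟩, -⟩ := hanti v
    obtain rfl := hunique v x y (hnotfar v x h1 h2 h3) (by omega)
    obtain ⟨u, hu, huw⟩ := (mem_sphereTwo.1 hw).2.2
    have := SimpleGraph.dist_le (Walk.cons hu (Walk.cons huw (Walk.cons hwx Walk.nil)))
    simp at this
    omega
  have hgeo : ∀ v u w, Γ.Adj v u → Γ.Adj u w → 2 ≤ Γ.dist v w → Is2Geodesic Γ v u w := by
    intro v u w h1 h2 h
    refine ⟨h1, h2, ?_, fun h' => ?_⟩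
    · rintro rfl
      simp at h
    · rw [SimpleGraph.dist_eq_one_iff_adj.2 h'] at h
      omega
  refine ⟨?_, ?_⟩
  · have := hconn.nonempty
    obtain ⟨a, b, hab⟩ := Γ.exists_dist_eq_diam
    refine le_antisymm (hab ▸ hle a b) ?_
    obtain ⟨x, h1, h2, h3, -⟩ := hanti a
    exact (hnotfar a x h1 h2 h3).trans
      (SimpleGraph.dist_le_diam (SimpleGraph.connected_iff_ediam_ne_top.1 hconn))
  · intro i hi1 hi3 f g hf hg
    interval_cases i
    · obtain ⟨φ, h0, h1⟩ := h2gt.1 (hf.1 0 (by omega)) (hg.1 0 (by omega))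
      refine ⟨φ, fun j hj => ?_⟩
      interval_cases j
      exacts [h0, h1]
    · obtain ⟨φ, h0, h1, h2⟩ := h2gt.2
        (hgeo _ _ _ (hf.1 0 (by omega)) (hf.1 1 (by omega)) hf.2.ge)
        (hgeo _ _ _ (hg.1 0 (by omega)) (hg.1 1 (by omega)) hg.2.ge)
      refine ⟨φ, fun j hj => ?_⟩
      interval_cases j
      exacts [h0, h1, h2]
    · have htwo : ∀ f : ℕ → V, IsIGeodesic Γ 3 f → 2 ≤ Γ.dist (f 0) (f 2) := by
        intro f hf
        have h1 := hconn.dist_triangle (u := f 0) (v := f 2) (w := f 3)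
        rw [hf.2, SimpleGraph.dist_eq_one_iff_adj.2 (hf.1 2 (by omega))] at h1
        omega
      obtain ⟨φ, h0, h1, h2⟩ := h2gt.2
        (hgeo _ _ _ (hf.1 0 (by omega)) (hf.1 1 (by omega)) (htwo f hf))
        (hgeo _ _ _ (hg.1 0 (by omega)) (hg.1 1 (by omega)) (htwo g hg))
      have h3 : φ (f 3) = g 3 := by
        refine hunique (g 0) _ _ ?_ hg.2.ge
        obtain ⟨n1, n2, n3⟩ := hfar _ _ hf.2.ge
        rw [← h0]
        exact hnotfar _ _ (φ.injective.ne n1) (fun h => n2 (φ.map_adj_iff.1 h))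
          fun h => n3 ((apply_mem_sphereTwo φ).1 h)
      refine ⟨φ, fun j hj => ?_⟩
      interval_cases j
      exacts [h0, h1, h2, h3]
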